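/- Let R be a commutative ring and A an R-algebra of finite expansion. Then the following conditions are equivalent: (a) for every prime p of R the fibre Spec(A ⊗_R κ(p)) is a totally disconnected topological space; (b) every prime q of A corresponds to a closed point of its fibre, i.e., for every prime q of A lying over p in R, the prime of A ⊗_R κ(p) corresponding to q is maximal; (c) for every prime q of A lying over the prime p of R, the residue field κ(q) is an algebraic field extension of κ(p). -/

import Mathlib

open TensorProduct

/-- An `R`-algebra `A` is of *finite expansion* if it is integral over a finitely
generated subalgebra, i.e. there is a finite set of quasi-generators. -/
def Algebra.FiniteExpansion (R A : Type*) [CommRing R] [CommRing A] [Algebra R A] : Prop :=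
  ∃ s : Finset A, Algebra.IsIntegral (Algebra.adjoin R (s : Set A)) A

/-- The fibre ring `A ⊗_R κ(p)` of `Spec A → Spec R` over a prime `p` of `R`, where
`κ(p) = Frac(R ⧸ p)` is the residue field at `p`. -/
abbrev fiberRing (R A : Type*) [CommRing R] [CommRing A] [Algebra R A] (p : Ideal R) :
    Type _ :=
  A ⊗[R] FractionRing (R ⧸ p)

/-- The canonical embedding of the residue field `κ(p)` of the prime `p = q ∩ R` of `R` into
the residue field `κ(q)` of a prime `q` of `A`. -/
noncomputable def residueFieldMap {R A : Type*} [CommRing R] [CommRing A] [Algebra R A]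
    (q : PrimeSpectrum A) :
    FractionRing (R ⧸ q.asIdeal.comap (algebraMap R A)) →+* FractionRing (A ⧸ q.asIdeal) :=
  IsFractionRing.lift
    (g := (algebraMap (A ⧸ q.asIdeal) (FractionRing (A ⧸ q.asIdeal))).comp
      (Ideal.quotientMap q.asIdeal (algebraMap R A) le_rfl))
    ((IsFractionRing.injective (A ⧸ q.asIdeal) (FractionRing (A ⧸ q.asIdeal))).comp
      Ideal.quotientMap_injective)

/-- The residue field `κ(q)` of a prime `q` of `A` as an algebra over the residue field
`κ(p)` of the prime `p = q ∩ R` of `R`. -/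
noncomputable instance residueFieldAlgebra {R A : Type*} [CommRing R] [CommRing A] [Algebra R A]
    (q : PrimeSpectrum A) :
    Algebra (FractionRing (R ⧸ q.asIdeal.comap (algebraMap R A)))
      (FractionRing (A ⧸ q.asIdeal)) :=
  (residueFieldMap q).toAlgebra

/-- In a ring of Krull dimension zero, distinct primes are separated by basic open sets. -/
theorem PrimeSpectrum.t2Space_of_krullDimLE_zero (B : Type*) [CommRing B]
    [Ring.KrullDimLE 0 B] : T2Space (PrimeSpectrum B) := by
  refine ⟨fun x y hxy ↦ ?_⟩
  obtain ⟨a, hax, hay⟩ : ∃ a ∈ x.asIdeal, a ∉ y.asIdeal := by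
    by_contra! h
    exact hxy (PrimeSpectrum.ext (x.2.isMaximal'.eq_of_le y.2.ne_top h))
  have hzero : (0 : B) ∈ x.asIdeal.primeCompl ⊔ Submonoid.powers a := by
    by_contra h
    obtain ⟨P, hP, -, hdisj⟩ := Ideal.exists_le_prime_disjoint (⊥ : Ideal B)
      (x.asIdeal.primeCompl ⊔ Submonoid.powers a)
      (Set.disjoint_left.mpr fun b hb hb' ↦ h (by rwa [← Ideal.mem_bot.mp hb]))
    have hle : P ≤ x.asIdeal := fun b hb ↦ by
      by_contra hbx
      exact Set.disjoint_left.mp hdisj hb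
        ((le_sup_left : x.asIdeal.primeCompl ≤ _ ⊔ Submonoid.powers a) hbx)
    have heq : P = x.asIdeal := hP.isMaximal'.eq_of_le x.2.ne_top hle
    exact Set.disjoint_left.mp hdisj (heq ▸ hax)
      ((le_sup_right : Submonoid.powers a ≤ x.asIdeal.primeCompl ⊔ _)
        (Submonoid.mem_powers a))
  obtain ⟨s, hs, _, ⟨n, rfl⟩, hsn⟩ := Submonoid.mem_sup.mp hzero
  refine ⟨_, _, (PrimeSpectrum.basicOpen s).2, (PrimeSpectrum.basicOpen a).2, hs, hay,
    Set.disjoint_left.mpr fun z hzs hza ↦ ?_⟩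
  have hmem : s * a ^ n ∈ z.asIdeal := hsn ▸ z.asIdeal.zero_mem
  exact (z.2.mem_or_mem hmem).elim hzs fun h ↦ hza (z.2.mem_of_pow_mem n h)

theorem PrimeSpectrum.isMaximal_of_totallyDisconnectedSpace {B : Type*} [CommRing B]
    [TotallyDisconnectedSpace (PrimeSpectrum B)] (x : PrimeSpectrum B) : x.asIdeal.IsMaximal :=
  (PrimeSpectrum.isClosed_singleton_iff_isMaximal x).mp isClosed_singleton

theorem PrimeSpectrum.totallyDisconnectedSpace_of_krullDimLE_zero (B : Type*) [CommRing B]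
    [Ring.KrullDimLE 0 B] : TotallyDisconnectedSpace (PrimeSpectrum B) :=
  have := PrimeSpectrum.t2Space_of_krullDimLE_zero B
  inferInstance

/-- The Zariski lemma for field extensions of finite expansion. -/
theorem Algebra.FiniteExpansion.isAlgebraic {F K : Type*} [Field F] [Field K] [Algebra F K]
    (h : Algebra.FiniteExpansion F K) : Algebra.IsAlgebraic F K := by
  obtain ⟨s, hs⟩ := h
  let C := Algebra.adjoin F (s : Set K)
  have hC : IsField C :=
    isField_of_isIntegral_of_isField (S := K) Subtype.val_injective (Field.toIsField K)
  let := hC.toField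
  have : Algebra.FiniteType F C :=
    (Subalgebra.fg_iff_finiteType _).mp (Subalgebra.fg_adjoin_finset s)
  have : Module.Finite F C := finite_of_finite_type_of_isJacobsonRing F C
  have : Algebra.IsIntegral F K := Algebra.IsIntegral.trans C
  infer_instance

/-- Finite expansion is stable under base change followed by a surjection. -/
theorem Algebra.FiniteExpansion.of_productMap_surjective {R A F K : Type*} [CommRing R]
    [CommRing A] [CommRing F] [CommRing K] [Algebra R A] [Algebra R F] [Algebra R K]
    [Algebra F K] [IsScalarTower R F K] (ψ : A →ₐ[R] K)
    (hψ : Function.Surjective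
      (Algebra.TensorProduct.productMap ψ (IsScalarTower.toAlgHom R F K)))
    (h : Algebra.FiniteExpansion R A) : Algebra.FiniteExpansion F K := by
  classical
  obtain ⟨s, hs⟩ := h
  refine ⟨s.image ψ, ⟨fun x ↦ ?_⟩⟩
  have hle : ∀ c ∈ Algebra.adjoin R (s : Set A),
      ψ c ∈ Algebra.adjoin F ((s.image ψ : Finset K) : Set K) := by
    intro c hc
    have : Algebra.adjoin R (s : Set A) ≤
        ((Algebra.adjoin F ((s.image ψ : Finset K) : Set K)).restrictScalars R).comap ψ :=
      Algebra.adjoin_le fun y hy ↦ Algebra.subset_adjoin (by simpa using ⟨y, hy, rfl⟩)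
    exact this hc
  let φ : Algebra.adjoin R (s : Set A) →+*
      Algebra.adjoin F ((s.image ψ : Finset K) : Set K) :=
    ((ψ : A →+* K).comp (Algebra.adjoin R (s : Set A)).val.toRingHom).codRestrict _
      fun c ↦ hle c c.2
  have hint (a : A) : IsIntegral (Algebra.adjoin F ((s.image ψ : Finset K) : Set K)) (ψ a) :=
    (hs.isIntegral a).map_of_comp_eq φ (ψ : A →+* K) rfl
  obtain ⟨t, rfl⟩ := hψ x
  induction t with
  | zero => simpa using isIntegral_zero
  | add t u ht hu => simpa using ht.add hu
  | tmul a c =>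
    rw [Algebra.TensorProduct.productMap_apply_tmul]
    exact (hint a).mul (isIntegral_algebraMap
      (x := algebraMap F (Algebra.adjoin F ((s.image ψ : Finset K) : Set K)) c))

section Fiber

variable {R A : Type*} [CommRing R] [CommRing A] [Algebra R A]

instance (q : PrimeSpectrum A) :
    IsScalarTower R (FractionRing (R ⧸ q.asIdeal.comap (algebraMap R A)))
      (FractionRing (A ⧸ q.asIdeal)) :=
  .of_algebraMap_eq fun r ↦ by
    change _ = residueFieldMap q (algebraMap (R ⧸ q.asIdeal.comap (algebraMap R A)) _
      (Ideal.Quotient.mk _ r))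
    rw [residueFieldMap, IsFractionRing.lift_algebraMap]
    rfl

/-- The canonical map from the fibre ring at `p = q ∩ R` to the residue field `κ(q)`. -/
noncomputable def fiberToResidueField (q : PrimeSpectrum A) :
    fiberRing R A (q.asIdeal.comap (algebraMap R A)) →ₐ[R] FractionRing (A ⧸ q.asIdeal) :=
  Algebra.TensorProduct.productMap (IsScalarTower.toAlgHom R A _)
    (IsScalarTower.toAlgHom R (FractionRing (R ⧸ q.asIdeal.comap (algebraMap R A))) _)

theorem fiberToResidueField_tmul_one (q : PrimeSpectrum A) (a : A) :
    fiberToResidueField (R := R) q (a ⊗ₜ 1) = algebraMap A _ a := by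
  simp [fiberToResidueField]

theorem algebraMap_residueField_eq_zero (q : PrimeSpectrum A) (a : A) :
    algebraMap A (FractionRing (A ⧸ q.asIdeal)) a = 0 ↔ a ∈ q.asIdeal := by
  rw [IsScalarTower.algebraMap_apply A (A ⧸ q.asIdeal),
    IsFractionRing.to_map_eq_zero_iff, Ideal.Quotient.algebraMap_eq,
    Ideal.Quotient.eq_zero_iff_mem]

theorem isUnit_algebraMap_fiberRing (p : Ideal R) [p.IsPrime] {r : R} (hr : r ∉ p) :
    IsUnit (algebraMap R (fiberRing R A p) r) := by
  have h : IsUnit (algebraMap R (FractionRing (R ⧸ p)) r) := by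
    have := algebraMap_residueField_eq_zero ⟨p, ‹_›⟩ r
    exact isUnit_iff_ne_zero.mpr (this.not.mpr hr)
  simpa using h.map (Algebra.TensorProduct.includeRight : _ →ₐ[R] fiberRing R A p)

/-- Every element of the fibre ring comes from `A` up to an element of `R` outside `p`. -/
theorem fiberRing_exists_smul_eq (p : Ideal R) [p.IsPrime] (t : fiberRing R A p) :
    ∃ r ∉ p, ∃ a : A, algebraMap R (fiberRing R A p) r * t = a ⊗ₜ 1 := by
  induction t using TensorProduct.induction_on with
  | zero => exact ⟨1, p.one_notMem, 0, by simp⟩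
  | add t u ht hu =>
    obtain ⟨r, hr, a, hra⟩ := ht
    obtain ⟨s, hs, b, hsb⟩ := hu
    refine ⟨r * s, p.primeCompl.mul_mem hr hs, s • a + r • b, ?_⟩
    rw [TensorProduct.add_tmul, ← TensorProduct.smul_tmul', ← TensorProduct.smul_tmul', ← hra,
      ← hsb, ← Algebra.smul_def, ← Algebra.smul_def, ← Algebra.smul_def, smul_add, mul_comm r,
      mul_smul, mul_comm s, mul_smul]
  | tmul a c =>
    obtain ⟨x, y, rfl⟩ := IsLocalization.exists_mk'_eq (nonZeroDivisors (R ⧸ p)) c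
    obtain ⟨x, rfl⟩ := Ideal.Quotient.mk_surjective x
    obtain ⟨y, hy⟩ := y
    obtain ⟨y, rfl⟩ := Ideal.Quotient.mk_surjective y
    refine ⟨y, fun h ↦ nonZeroDivisors.ne_zero hy (Ideal.Quotient.eq_zero_iff_mem.mpr h),
      x • a, ?_⟩
    rw [← Algebra.smul_def, TensorProduct.smul_tmul, ← TensorProduct.tmul_smul]
    congr 1
    rw [Algebra.smul_def, Algebra.smul_def, mul_one]
    exact IsLocalization.mk'_spec' _ (Ideal.Quotient.mk p x) ⟨Ideal.Quotient.mk p y, hy⟩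

/-- A prime of the fibre ring is determined by its contraction to `A`. -/
theorem comap_includeLeft_fiberRing_injective (p : Ideal R) [p.IsPrime] :
    Function.Injective (PrimeSpectrum.comap
      (Algebra.TensorProduct.includeLeftRingHom : A →+* fiberRing R A p)) := by
  intro x y hxy
  ext t
  obtain ⟨r, hr, a, hra⟩ := fiberRing_exists_smul_eq p t
  have hu := isUnit_algebraMap_fiberRing (A := A) p hr
  have key (z : PrimeSpectrum (fiberRing R A p)) : t ∈ z.asIdeal ↔
      a ∈ (PrimeSpectrum.comap
        (Algebra.TensorProduct.includeLeftRingHom : A →+* fiberRing R A p) z).asIdeal := by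
    rw [← Ideal.unit_mul_mem_iff_mem _ hu, hra]
    rfl
  rw [key, key, hxy]

/-- The contraction to `R` of a prime of the fibre ring at `p` is `p`. -/
theorem comap_comap_includeLeft_fiberRing (p : Ideal R) [p.IsPrime]
    (x : PrimeSpectrum (fiberRing R A p)) :
    (PrimeSpectrum.comap (Algebra.TensorProduct.includeLeftRingHom : A →+* fiberRing R A p)
      x).asIdeal.comap (algebraMap R A) = p := by
  ext r
  change algebraMap R (fiberRing R A p) r ∈ x.asIdeal ↔ r ∈ p
  refine ⟨fun h ↦ ?_, fun h ↦ ?_⟩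
  · by_contra hr
    exact x.2.ne_top (Ideal.eq_top_of_isUnit_mem _ h (isUnit_algebraMap_fiberRing p hr))
  · have h0 : algebraMap R (FractionRing (R ⧸ p)) r = 0 :=
      (algebraMap_residueField_eq_zero ⟨p, ‹_›⟩ r).mpr h
    rw [← (Algebra.TensorProduct.includeRight : _ →ₐ[R] fiberRing R A p).commutes r, h0, map_zero]
    exact x.asIdeal.zero_mem

/-- The prime of the fibre ring at `p = q ∩ R` corresponding to `q`. -/
noncomputable def fiberPoint (q : PrimeSpectrum A) :
    PrimeSpectrum (fiberRing R A (q.asIdeal.comap (algebraMap R A))) :=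
  ⟨RingHom.ker (fiberToResidueField (R := R) q), RingHom.ker_isPrime _⟩

theorem comap_fiberPoint (q : PrimeSpectrum A) :
    PrimeSpectrum.comap Algebra.TensorProduct.includeLeftRingHom (fiberPoint (R := R) q) = q := by
  ext a
  change fiberToResidueField (R := R) q (a ⊗ₜ 1) = 0 ↔ a ∈ q.asIdeal
  rw [fiberToResidueField_tmul_one, algebraMap_residueField_eq_zero]

theorem fiberToResidueField_surjective (q : PrimeSpectrum A)
    (hq : (fiberPoint (R := R) q).asIdeal.IsMaximal) :
    Function.Surjective (fiberToResidueField (R := R) q) := by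
  intro x
  obtain ⟨a, b, rfl⟩ := IsLocalization.exists_mk'_eq (nonZeroDivisors (A ⧸ q.asIdeal)) x
  obtain ⟨a, rfl⟩ := Ideal.Quotient.mk_surjective a
  obtain ⟨b, hb⟩ := b
  obtain ⟨b, rfl⟩ := Ideal.Quotient.mk_surjective b
  have hbq : b ∉ q.asIdeal := fun h ↦
    nonZeroDivisors.ne_zero hb (Ideal.Quotient.eq_zero_iff_mem.mpr h)
  have hbx : b ⊗ₜ 1 ∉ (fiberPoint (R := R) q).asIdeal := fun h ↦ by
    rw [← comap_fiberPoint (R := R) q] at hbq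
    exact hbq h
  obtain ⟨c, m, hm, hc⟩ := hq.exists_inv hbx
  have hfm : fiberToResidueField (R := R) q m = 0 := hm
  have hfc : fiberToResidueField (R := R) q c *
      algebraMap A (FractionRing (A ⧸ q.asIdeal)) b = 1 := by
    rw [← fiberToResidueField_tmul_one (R := R), ← map_mul,
      ← add_zero (fiberToResidueField (R := R) q _), ← hfm, ← map_add, hc, map_one]
  refine ⟨a ⊗ₜ 1 * c, ?_⟩
  rw [map_mul, fiberToResidueField_tmul_one, eq_comm, IsLocalization.mk'_eq_iff_eq_mul, mul_assoc]
  exact (by rw [hfc, mul_one] : _ = algebraMap A _ a * (_ * algebraMap A _ b))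

theorem fiberPoint_isMaximal (q : PrimeSpectrum A)
    [Algebra.IsAlgebraic (FractionRing (R ⧸ q.asIdeal.comap (algebraMap R A)))
      (FractionRing (A ⧸ q.asIdeal))] :
    (fiberPoint (R := R) q).asIdeal.IsMaximal := by
  let κ := FractionRing (R ⧸ q.asIdeal.comap (algebraMap R A))
  let S : Subalgebra κ (FractionRing (A ⧸ q.asIdeal)) :=
    { (fiberToResidueField (R := R) q).range with
      algebraMap_mem' := fun c ↦ ⟨1 ⊗ₜ c, by simp [fiberToResidueField, κ]⟩ }
  have hS : IsField S := S.isField_of_algebraic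
  exact Ideal.Quotient.maximal_of_isField _
    ((RingHom.quotientKerEquivRange (fiberToResidueField (R := R) q).toRingHom).toMulEquiv.isField
      hS)

end Fiber

/-- For an `R`-algebra `A` of finite expansion, the following are equivalent:
(a) all fibres `Spec (A ⊗_R κ(p))` of `Spec A → Spec R` are totally disconnected;
(b) every prime `q` of `A` is closed in its fibre, i.e. the prime of `A ⊗_R κ(p)`
corresponding to `q` is maximal; (c) for every prime `q` of `A` lying over `p` in `R`, the
residue field `κ(q)` is an algebraic field extension of `κ(p)`. -/
theorem quasiProfinite_tfae (R A : Type*) [CommRing R] [CommRing A] [Algebra R A]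
    (hA : Algebra.FiniteExpansion R A) :
    List.TFAE [
      ∀ p : Ideal R, p.IsPrime → TotallyDisconnectedSpace (PrimeSpectrum (fiberRing R A p)),
      ∀ (q : PrimeSpectrum A)
        (q' : PrimeSpectrum (fiberRing R A (q.asIdeal.comap (algebraMap R A)))),
        PrimeSpectrum.comap Algebra.TensorProduct.includeLeftRingHom q' = q →
          q'.asIdeal.IsMaximal,
      ∀ q : PrimeSpectrum A,
        Algebra.IsAlgebraic (FractionRing (R ⧸ q.asIdeal.comap (algebraMap R A)))
          (FractionRing (A ⧸ q.asIdeal))] := by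
  tfae_have 1 → 2 := fun h q q' _ ↦
    have := h _ (q.2.comap (algebraMap R A))
    PrimeSpectrum.isMaximal_of_totallyDisconnectedSpace q'
  tfae_have 2 → 1 := fun h p hp ↦ by
    have hmax (q : PrimeSpectrum A) (hq : q.asIdeal.comap (algebraMap R A) = p)
        (x : PrimeSpectrum (fiberRing R A p))
        (hx : PrimeSpectrum.comap Algebra.TensorProduct.includeLeftRingHom x = q) :
        x.asIdeal.IsMaximal := by
      subst hq
      exact h q x hx
    have : Ring.KrullDimLE 0 (fiberRing R A p) := .mk₀ fun I hI ↦
      hmax _ (comap_comap_includeLeft_fiberRing p ⟨I, hI⟩) ⟨I, hI⟩ rfl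
    exact PrimeSpectrum.totallyDisconnectedSpace_of_krullDimLE_zero _
  tfae_have 2 → 3 := fun h q ↦
    (hA.of_productMap_surjective _ (fiberToResidueField_surjective q
      (h q _ (comap_fiberPoint q)))).isAlgebraic
  tfae_have 3 → 2 := fun h q q' hq' ↦ by
    have := h q
    obtain rfl : q' = fiberPoint q :=
      comap_includeLeft_fiberRing_injective _ (hq'.trans (comap_fiberPoint q).symm)
    exact fiberPoint_isMaximal q
  tfae_finish
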